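/- For every integer q ≥ 6 and every real number c with 1 < c < (q-2)·(q²-q-4)/((q²-5q+8)·(q+1)), there exists a finite simple graph G on n vertices with minimum degree at least (1 - 1/(c·(q+1)))·n such that G admits no fractional K_q-decomposition. -/

import Mathlib

open scoped Classical

/-- A fractional `K_q`-decomposition of `G`: an assignment of non-negative real weights to the
copies of `K_q` (i.e. the `q`-cliques) of `G` such that for every edge of `G`, the total weight
of the `q`-cliques containing that edge is exactly `1`. -/
def SimpleGraph.HasFractionalDecomposition {V : Type*} [Fintype V] (G : SimpleGraph V)
    (q : ℕ) : Prop :=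
  ∃ w : Finset V → ℝ, (∀ s, 0 ≤ w s) ∧
    ∀ ⦃u v : V⦄, G.Adj u v →
      ∑ s ∈ Finset.univ.filter (fun s : Finset V => G.IsNClique q s ∧ u ∈ s ∧ v ∈ s), w s = 1

/-- LP duality: an edge weighting that is non-negative on every `q`-clique and negative in total
rules out a fractional `K_q`-decomposition. Sums run over ordered pairs. -/
theorem SimpleGraph.HasFractionalDecomposition.sum_nonneg {V : Type*} [Fintype V]
    {G : SimpleGraph V} {q : ℕ} (h : G.HasFractionalDecomposition q) (y : V → V → ℝ)
    (hy : ∀ s, G.IsNClique q s → 0 ≤ ∑ u ∈ s, ∑ v ∈ s, if G.Adj u v then y u v else 0) :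
    0 ≤ ∑ u, ∑ v, if G.Adj u v then y u v else 0 := by
  obtain ⟨w, hw, hsum⟩ := h
  have key : ∑ u, ∑ v, (if G.Adj u v then y u v else 0) =
      ∑ s : Finset V, if G.IsNClique q s then
        w s * ∑ u ∈ s, ∑ v ∈ s, (if G.Adj u v then y u v else 0) else 0 := by
    calc ∑ u, ∑ v, (if G.Adj u v then y u v else 0)
        = ∑ u, ∑ v, ∑ s : Finset V, if G.IsNClique q s ∧ u ∈ s ∧ v ∈ s then
            w s * (if G.Adj u v then y u v else 0) else 0 := by
          refine Finset.sum_congr rfl fun u _ => Finset.sum_congr rfl fun v _ => ?_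
          rw [← Finset.sum_filter, ← Finset.sum_mul]
          by_cases huv : G.Adj u v
          · rw [hsum huv, one_mul]
          · simp [huv]
      _ = ∑ s : Finset V, ∑ u, ∑ v, if G.IsNClique q s ∧ u ∈ s ∧ v ∈ s then
            w s * (if G.Adj u v then y u v else 0) else 0 := by
          rw [Finset.sum_comm]
          conv_lhs => enter [2, v]; rw [Finset.sum_comm]
          rw [Finset.sum_comm]
          exact Finset.sum_congr rfl fun s _ => Finset.sum_comm
      _ = _ := by
          refine Finset.sum_congr rfl fun s _ => ?_
          by_cases hs : G.IsNClique q s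
          · rw [if_pos hs, Finset.mul_sum, ← Finset.sum_filter_add_sum_filter_not Finset.univ (· ∈ s)]
            rw [Finset.sum_eq_zero (s := Finset.univ.filter fun u => ¬ u ∈ s)]
            · simp only [Finset.filter_univ_mem, add_zero]
              refine Finset.sum_congr rfl fun u hu => ?_
              rw [Finset.mul_sum]
              simp only [hs, hu, true_and]
              rw [← Finset.sum_filter, Finset.filter_univ_mem]
            · intro u hu
              simp [(Finset.mem_filter.1 hu).2]
          · simp [hs]
  rw [key]
  refine Finset.sum_nonneg fun s _ => ?_
  split_ifs with hs
  · exact mul_nonneg (hw s) (hy s hs)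
  · exact le_rfl

/-- Since `x ^ 2 ≥ 3 * x - 2` for integers, distributing `s` over the classes of `f` leaves at
least `3 * #s - 2 * #ι` ordered pairs of elements within the same class. -/
theorem three_mul_card_le_sum_card_fiber {V ι : Type*} [Fintype ι] [DecidableEq ι]
    (f : V → ι) (s : Finset V) :
    (3 * s.card : ℤ) ≤ ∑ u ∈ s, ((s.filter fun v => f v = f u).card : ℤ) + 2 * Fintype.card ι := by
  have h1 : (s.card : ℤ) = ∑ i : ι, ((s.filter fun v => f v = i).card : ℤ) := by
    exact_mod_cast Finset.card_eq_sum_card_fiberwise (t := Finset.univ) (by simp [Set.MapsTo])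
  have h2 : ∑ u ∈ s, ((s.filter fun v => f v = f u).card : ℤ) =
      ∑ i : ι, ((s.filter fun v => f v = i).card : ℤ) ^ 2 := by
    rw [← Finset.sum_fiberwise s f]
    refine Finset.sum_congr rfl fun i _ => ?_
    rw [Finset.sum_congr rfl (g := fun _ => ((s.filter fun v => f v = i).card : ℤ))]
    · rw [Finset.sum_const, nsmul_eq_mul, sq]
    · intro u hu
      rw [(Finset.mem_filter.1 hu).2]
  have h3 : (2 * Fintype.card ι : ℤ) = ∑ _i : ι, (2 : ℤ) := by simp [mul_comm]
  rw [h1, h2, h3, Finset.mul_sum, ← Finset.sum_add_distrib]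
  refine Finset.sum_le_sum fun i _ => ?_
  generalize ((s.filter fun v => f v = i).card : ℤ) = x
  rcases le_or_gt x 1 with hx | hx <;> nlinarith

/-- If the vertices are split into `q - 2` classes and every vertex has too few neighbours in its
own class compared to the other classes, there is no fractional `K_q`-decomposition. -/
theorem SimpleGraph.not_hasFractionalDecomposition_of_partition {V ι : Type*} [Fintype V]
    [Nonempty V] [Fintype ι] [DecidableEq ι] (G : SimpleGraph V) (q : ℕ) (f : V → ι)
    (hι : Fintype.card ι + 2 = q)
    (h : ∀ u, ((q : ℝ) ^ 2 - q - 4) * (Finset.univ.filter fun v => G.Adj u v ∧ f v = f u).card <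
      4 * (Finset.univ.filter fun v => G.Adj u v ∧ f v ≠ f u).card) :
    ¬ G.HasFractionalDecomposition q := by
  intro hG
  have hpos := hG.sum_nonneg
    (fun u v => if f v = f u then (q : ℝ) ^ 2 - q - 4 else -4) ?_
  · refine hpos.not_gt (Finset.sum_neg (fun u _ => ?_) Finset.univ_nonempty)
    have hu := h u
    calc _ = ∑ v, ((if G.Adj u v ∧ f v = f u then (q : ℝ) ^ 2 - q - 4 else 0) +
            if G.Adj u v ∧ f v ≠ f u then (-4 : ℝ) else 0) := by
          refine Finset.sum_congr rfl fun v _ => ?_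
          by_cases h1 : G.Adj u v <;> by_cases h2 : f v = f u <;> simp [h1, h2]
      _ < 0 := by
          rw [Finset.sum_add_distrib, ← Finset.sum_filter, ← Finset.sum_filter,
            Finset.sum_const, Finset.sum_const, nsmul_eq_mul, nsmul_eq_mul]
          linarith
  · intro s hs
    have hcard : (s.card : ℝ) = q := by exact_mod_cast hs.card_eq
    have hfib : (3 * s.card : ℝ) ≤
        ∑ u ∈ s, ((s.filter fun v => f v = f u).card : ℝ) + 2 * Fintype.card ι := by
      exact_mod_cast three_mul_card_le_sum_card_fiber f s
    have hι' : (Fintype.card ι : ℝ) = q - 2 := by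
      rw [← hι]; push_cast; ring
    have hrow : ∀ u ∈ s, (∑ v ∈ s, if G.Adj u v then
        (if f v = f u then (q : ℝ) ^ 2 - q - 4 else -4) else 0) =
        ((q : ℝ) ^ 2 - q) * (s.filter fun v => f v = f u).card - 4 * q -
          ((q : ℝ) ^ 2 - q - 4) := by
      intro u hu
      calc _ = ∑ v ∈ s, ((if f v = f u then (q : ℝ) ^ 2 - q else 0) - 4 -
            if v = u then (q : ℝ) ^ 2 - q - 4 else 0) := by
            refine Finset.sum_congr rfl fun v hv => ?_
            by_cases huv : v = u
            · subst huv; simp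
            · have : G.Adj u v := hs.isClique hu hv (Ne.symm huv)
              by_cases h2 : f v = f u <;> simp [this, huv, h2]
        _ = _ := by
            rw [Finset.sum_sub_distrib, Finset.sum_sub_distrib, ← Finset.sum_filter,
              Finset.sum_const, Finset.sum_const, Finset.sum_ite_eq' s u, if_pos hu,
              nsmul_eq_mul, nsmul_eq_mul, hcard]
            ring
    rw [Finset.sum_congr rfl hrow, Finset.sum_sub_distrib, Finset.sum_sub_distrib,
      ← Finset.mul_sum, Finset.sum_const, Finset.sum_const, nsmul_eq_mul, nsmul_eq_mul, hcard]
    rw [hcard, hι'] at hfib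
    have hq : (2 : ℝ) ≤ q := by exact_mod_cast (by omega : 2 ≤ q)
    nlinarith [mul_le_mul_of_nonneg_left hfib (by nlinarith : (0 : ℝ) ≤ (q : ℝ) ^ 2 - q)]

/-- The join of `p` copies of the graph on `ZMod m` in which distinct `x`, `y` are adjacent when
the residue of `x + y` is less than `d`. -/
def sumGraphJoin (p m d : ℕ) : SimpleGraph (Fin p × ZMod m) where
  Adj u v := u ≠ v ∧ (v.1 = u.1 → (u.2 + v.2).val < d)
  symm := ⟨fun u v h => ⟨h.1.symm, fun e => by rw [add_comm]; exact h.2 e.symm⟩⟩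
  loopless := ⟨fun _ h => h.1 rfl⟩

theorem card_filter_val_add_lt {p m d : ℕ} [NeZero m] (hd : d ≤ m) (u : Fin p × ZMod m) :
    (Finset.univ.filter fun v : Fin p × ZMod m => v.1 = u.1 ∧ (u.2 + v.2).val < d).card = d := by
  conv_rhs => rw [← Finset.card_range d]
  refine Finset.card_nbij' (fun v => (u.2 + v.2).val) (fun k => (u.1, (k : ZMod m) - u.2))
    ?_ ?_ ?_ ?_
  · intro v hv
    simp at hv
    simpa using hv.2
  · intro k hk
    simp at hk
    simp [ZMod.val_natCast, Nat.mod_eq_of_lt (hk.trans_le hd), hk]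
  · rintro ⟨i, x⟩ hv
    simp at hv
    simp [hv.1]
  · intro k hk
    simp at hk
    simp [ZMod.val_natCast, Nat.mod_eq_of_lt (hk.trans_le hd)]

theorem card_filter_fst_ne {p m : ℕ} [NeZero m] (u : Fin p × ZMod m) :
    (Finset.univ.filter fun v : Fin p × ZMod m => v.1 ≠ u.1).card = (p - 1) * m := by
  have : (Finset.univ.filter fun v : Fin p × ZMod m => v.1 ≠ u.1) =
      (Finset.univ.erase u.1) ×ˢ Finset.univ := by
    ext v; simp
  rw [this, Finset.card_product, Finset.card_erase_of_mem (Finset.mem_univ _)]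
  simp [ZMod.card]

theorem sumGraphJoin_card_inner_le {p m d : ℕ} [NeZero m] (hd : d ≤ m) (u : Fin p × ZMod m) :
    (Finset.univ.filter fun v => (sumGraphJoin p m d).Adj u v ∧ v.1 = u.1).card ≤ d := by
  conv_rhs => rw [← card_filter_val_add_lt hd u]
  refine Finset.card_le_card fun v => ?_
  simp only [Finset.mem_filter, Finset.mem_univ, true_and]
  exact fun h => ⟨h.2, h.1.2 h.2⟩

theorem sumGraphJoin_card_outer {p m d : ℕ} [NeZero m] (u : Fin p × ZMod m) :
    (Finset.univ.filter fun v => (sumGraphJoin p m d).Adj u v ∧ v.1 ≠ u.1).card =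
      (p - 1) * m := by
  rw [← card_filter_fst_ne u]
  congr 1
  ext v
  simp only [Finset.mem_filter, Finset.mem_univ, true_and, and_iff_right_iff_imp]
  exact fun h => ⟨fun e => h (by rw [e]), fun e => absurd e h⟩

theorem sumGraphJoin_card_adj {p m d : ℕ} [NeZero m] (hd : d ≤ m) (u : Fin p × ZMod m) :
    (p - 1) * m + d ≤ (Finset.univ.filter fun v => (sumGraphJoin p m d).Adj u v).card + 1 := by
  calc (p - 1) * m + d
      = ((Finset.univ.filter fun v : Fin p × ZMod m => v.1 ≠ u.1) ∪
          Finset.univ.filter fun v : Fin p × ZMod m => v.1 = u.1 ∧ (u.2 + v.2).val < d).card := by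
        rw [Finset.card_union_of_disjoint, card_filter_fst_ne, card_filter_val_add_lt hd]
        rw [Finset.disjoint_filter]
        exact fun v _ h h' => h h'.1
    _ ≤ (insert u (Finset.univ.filter fun v => (sumGraphJoin p m d).Adj u v)).card := by
        refine Finset.card_le_card fun v => ?_
        simp only [Finset.mem_union, Finset.mem_filter, Finset.mem_univ, true_and,
          Finset.mem_insert]
        intro h
        by_cases e : v = u
        · exact Or.inl e
        · exact Or.inr ⟨Ne.symm e, fun e' => (h.resolve_left fun h' => h' e').2⟩
    _ ≤ _ := Finset.card_insert_le _ _

theorem Equiv.card_filter_eq {α β : Type*} [Fintype α] [Fintype β] (e : α ≃ β)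
    {P : α → Prop} {Q : β → Prop} [DecidablePred P] [DecidablePred Q] (h : ∀ a, P a ↔ Q (e a)) :
    (Finset.univ.filter P).card = (Finset.univ.filter Q).card :=
  Finset.card_equiv e (by simp [h])

theorem exists_nat_between_mul {α β : ℝ} (hα : 0 ≤ α) (h : α < β) :
    ∃ m d : ℕ, 0 < m ∧ α * m + 1 ≤ d ∧ d < β * m := by
  obtain ⟨m, hm⟩ := exists_nat_gt (2 / (β - α))
  have hβα : 0 < β - α := sub_pos.2 h
  have hm0 : (0 : ℝ) < m := lt_trans (by positivity) hm
  rw [div_lt_iff₀ hβα] at hm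
  refine ⟨m, ⌈α * m⌉₊ + 1, by exact_mod_cast hm0, ?_, ?_⟩
  · push_cast
    linarith [Nat.le_ceil (α * m)]
  · push_cast
    linarith [Nat.ceil_lt_add_one (mul_nonneg hα hm0.le)]

/-- For every integer `q ≥ 6` and every real `c` with
`1 < c < (q-2)·(q²-q-4)/((q²-5q+8)·(q+1))`, there exists a finite simple graph `G` on `n`
vertices with minimum degree at least `(1 - 1/(c·(q+1)))·n` admitting no fractional
`K_q`-decomposition. -/
theorem statement17 (q : ℕ) (hq : 6 ≤ q) (c : ℝ) (hc1 : 1 < c)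
    (hc2 : c < ((q : ℝ) - 2) * ((q : ℝ) ^ 2 - q - 4)
      / (((q : ℝ) ^ 2 - 5 * q + 8) * ((q : ℝ) + 1))) :
    ∃ (n : ℕ) (G : SimpleGraph (Fin n)),
      (1 - 1 / (c * (q + 1))) * n ≤ (G.minDegree : ℝ) ∧
      ¬ G.HasFractionalDecomposition q := by
  have hqr : (6 : ℝ) ≤ q := by exact_mod_cast hq
  have hA : 0 < (q : ℝ) ^ 2 - q - 4 := by nlinarith
  have hB : 0 < (q : ℝ) ^ 2 - 5 * q + 8 := by nlinarith
  have hC : 0 < c * ((q : ℝ) + 1) := by positivity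
  have hα : 0 ≤ 1 - ((q : ℝ) - 2) / (c * (q + 1)) := by
    rw [sub_nonneg, div_le_one hC]
    nlinarith
  have hαβ : 1 - ((q : ℝ) - 2) / (c * (q + 1)) < 4 * (q - 3) / ((q : ℝ) ^ 2 - q - 4) := by
    rw [lt_div_iff₀ (by positivity)] at hc2
    rw [sub_lt_iff_lt_add, div_add_div _ _ hA.ne' hC.ne', lt_div_iff₀ (by positivity)]
    nlinarith
  obtain ⟨m, d, hm, hd1, hd2⟩ := exists_nat_between_mul hα hαβ
  have hmr : (0 : ℝ) < m := by exact_mod_cast hm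
  rw [div_mul_eq_mul_div, lt_div_iff₀ hA] at hd2
  have hdm : d ≤ m := by
    have : (d : ℝ) ≤ m := by
      by_contra! hlt
      nlinarith [mul_pos hmr hB, mul_pos (sub_pos.2 hlt) hA]
    exact_mod_cast this
  have : NeZero m := ⟨hm.ne'⟩
  obtain ⟨p, rfl⟩ : ∃ p, q = p + 2 := ⟨q - 2, by omega⟩
  have hp : ((p - 1 : ℕ) : ℝ) = p - 1 := by
    rw [Nat.cast_sub (by omega)]; simp
  have hcard : Fintype.card (Fin p × ZMod m) = p * m := by simp [ZMod.card]
  let e : Fin (p * m) ≃ Fin p × ZMod m := (Fintype.equivFinOfCardEq hcard).symm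
  have : Nonempty (Fin (p * m)) := ⟨⟨0, Nat.mul_pos (by omega) hm⟩⟩
  obtain ⟨G, hG⟩ : ∃ G : SimpleGraph (Fin (p * m)),
      ∀ u v, G.Adj u v ↔ (sumGraphJoin p m d).Adj (e u) (e v) :=
    ⟨(sumGraphJoin p m d).comap e, fun _ _ => Iff.rfl⟩
  refine ⟨p * m, G, ?_, ?_⟩
  · have hdeg : (p - 1) * m + d ≤ G.minDegree + 1 := by
      obtain ⟨u, hu⟩ := G.exists_minimal_degree_vertex
      rw [hu, ← SimpleGraph.card_neighborFinset_eq_degree, SimpleGraph.neighborFinset_eq_filter,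
        e.card_filter_eq (Q := fun v => (sumGraphJoin p m d).Adj (e u) v) fun v => hG u v]
      exact sumGraphJoin_card_adj hdm (e u)
    have hdeg' : ((p : ℝ) - 1) * m + d ≤ G.minDegree + 1 := by
      rw [← hp]; exact_mod_cast hdeg
    have hid : (1 - 1 / (c * (((p + 2 : ℕ) : ℝ) + 1))) * ((p * m : ℕ) : ℝ) =
        (p - 1) * m + (1 - (((p + 2 : ℕ) : ℝ) - 2) / (c * (((p + 2 : ℕ) : ℝ) + 1))) * m := by
      push_cast
      ring
    rw [hid]
    linarith
  · refine SimpleGraph.not_hasFractionalDecomposition_of_partition _ _ (fun v => (e v).1)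
      (by simp) fun u => ?_
    rw [e.card_filter_eq (Q := fun v => (sumGraphJoin p m d).Adj (e u) v ∧ v.1 = (e u).1)
        fun v => and_congr_left' (hG u v),
      e.card_filter_eq (Q := fun v => (sumGraphJoin p m d).Adj (e u) v ∧ v.1 ≠ (e u).1)
        fun v => and_congr_left' (hG u v),
      sumGraphJoin_card_outer, Nat.cast_mul, hp]
    have hin : ((Finset.univ.filter fun v => (sumGraphJoin p m d).Adj (e u) v ∧
        v.1 = (e u).1).card : ℝ) ≤ d := by
      exact_mod_cast sumGraphJoin_card_inner_le hdm (e u)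
    refine (mul_le_mul_of_nonneg_left hin hA.le).trans_lt ?_
    rw [mul_comm]
    refine hd2.trans_eq ?_
    push_cast
    ring
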